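/- Let M be a von Neumann algebra and let T : M → M be a linear map (not assumed continuous). The following statements are equivalent: (a) T is a generalized derivation, i.e., T(xy) = T(x)y + xT(y) − xT(1)y for all x, y ∈ M; (b) aT(b)c = 0 whenever a, b, c ∈ M satisfy ab = bc = 0; (c) aT(b)c = 0 whenever a, b, c are self-adjoint elements of M with ab = bc = 0; (d) aT(b)c + cT(b)a = 0 whenever a, b, c are self-adjoint elements of M with ab = bc = 0; (e) aT(b)a = 0 whenever a, b are self-adjoint elements of M with ab = 0. -/

import Mathlib

section JordanDerivation

variable {R : Type*} [Ring R]

/-- In a semiprime ring without `2`-torsion, `a x b + b x a = 0` for all `x` forces `a x b = 0`. -/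
theorem mul_mul_eq_zero_of_add_swap_eq_zero (two : ∀ r : R, r + r = 0 → r = 0)
    (semiprime : ∀ r : R, (∀ x, r * x * r = 0) → r = 0) {a b : R}
    (h : ∀ x, a * x * b + b * x * a = 0) (x : R) : a * x * b = 0 := by
  refine semiprime _ fun y => two _ ?_
  linear_combination (norm := noncomm_ring) a * x * h y * x * b - h (x * a * y) * x * b
    + h x * y * a * x * b

variable {D : R →+ R}

theorem map_mul_add_mul_of_map_sq (hD : ∀ x, D (x * x) = D x * x + x * D x) (x y : R) :
    D (x * y) + D (y * x) = D x * y + x * D y + D y * x + y * D x := by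
  have h := hD (x + y)
  simp only [mul_add, add_mul, map_add] at h
  linear_combination (norm := noncomm_ring) h - hD x - hD y

theorem map_mul_mul_self_of_map_sq (two : ∀ r : R, r + r = 0 → r = 0)
    (hD : ∀ x, D (x * x) = D x * x + x * D x) (x y : R) :
    D (x * y * x) = D x * y * x + x * D y * x + x * y * D x := by
  have h₁ := map_mul_add_mul_of_map_sq hD x (x * y + y * x)
  have h₂ := map_mul_add_mul_of_map_sq hD (x * x) y
  have h₃ := map_mul_add_mul_of_map_sq hD x y
  simp only [mul_add, add_mul, map_add, ← mul_assoc] at h₁ h₂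
  refine sub_eq_zero.mp (two _ ?_)
  linear_combination (norm := noncomm_ring) h₁ - h₂ + x * h₃ + h₃ * x - hD x * y - y * hD x

theorem map_mul_mul_add_of_map_sq (two : ∀ r : R, r + r = 0 → r = 0)
    (hD : ∀ x, D (x * x) = D x * x + x * D x) (x y z : R) :
    D (x * y * z) + D (z * y * x) = D x * y * z + x * D y * z + x * y * D z
      + D z * y * x + z * D y * x + z * y * D x := by
  have h := map_mul_mul_self_of_map_sq two hD (x + z) y
  simp only [mul_add, add_mul, map_add] at h
  linear_combination (norm := noncomm_ring) h - map_mul_mul_self_of_map_sq two hD x y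
    - map_mul_mul_self_of_map_sq two hD z y

/-- A Jordan derivation of a semiprime ring without `2`-torsion is a derivation. -/
theorem map_mul_of_map_sq (two : ∀ r : R, r + r = 0 → r = 0)
    (semiprime : ∀ r : R, (∀ x, r * x * r = 0) → r = 0)
    (hD : ∀ x, D (x * x) = D x * x + x * D x) (x y : R) :
    D (x * y) = D x * y + x * D y := by
  let δ : R → R → R := fun a b => D (a * b) - D a * b - a * D b
  have δ_add_left (a b c : R) : δ (a + b) c = δ a c + δ b c := by
    simp only [δ, add_mul, map_add]; abel
  have δ_add_right (a b c : R) : δ a (b + c) = δ a b + δ a c := by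
    simp only [δ, mul_add, map_add]; abel
  have δ_swap (a b x : R) : δ a b * x * (a * b - b * a) + (a * b - b * a) * x * δ a b = 0 := by
    have h₁ := map_mul_mul_self_of_map_sq two hD a (b * x * b)
    have h₂ := map_mul_mul_self_of_map_sq two hD b (a * x * a)
    have h₃ := map_mul_mul_self_of_map_sq two hD b x
    have h₄ := map_mul_mul_self_of_map_sq two hD a x
    have h₅ := map_mul_mul_add_of_map_sq two hD (a * b) x (b * a)
    have h₆ := map_mul_add_mul_of_map_sq hD a b
    have h₇ : D (b * a) = D a * b + a * D b + D b * a + b * D a - D (a * b) := by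
      rw [← h₆]; abel
    rw [h₃] at h₁
    rw [h₄] at h₂
    rw [h₇] at h₅
    simp only [δ, ← mul_assoc] at h₁ h₂ h₅ ⊢
    linear_combination (norm := noncomm_ring) h₅ - h₁ - h₂
  have comm_δ (a b x : R) : (a * b - b * a) * x * δ a b = 0 :=
    mul_mul_eq_zero_of_add_swap_eq_zero two semiprime
      (fun x => by rw [add_comm]; exact δ_swap a b x) x
  have δ_comm (a b x : R) : δ a b * x * (a * b - b * a) = 0 :=
    mul_mul_eq_zero_of_add_swap_eq_zero two semiprime (δ_swap a b) x
  have δ_comm_left (a b c x : R) : δ a b * x * (c * b - b * c) = 0 := by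
    refine semiprime _ fun y => ?_
    have h := δ_comm (a + c) b x
    rw [δ_add_left] at h
    linear_combination (norm := noncomm_ring) δ a b * x * (c * b - b * c) * y *
      (h - δ_comm a b x - δ_comm c b x) - δ a b * x * comm_δ c b y * x * (a * b - b * a)
  have comm_δ_left (a b c x : R) : (c * b - b * c) * x * δ a b = 0 := by
    refine semiprime _ fun y => ?_
    linear_combination (norm := noncomm_ring) (c * b - b * c) * x * δ_comm_left a b c y * x * δ a b
  have δ_comm_all (a b c d x : R) : δ a b * x * (c * d - d * c) = 0 := by
    refine semiprime _ fun y => ?_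
    have h := δ_comm_left a (b + d) c x
    rw [δ_add_right] at h
    linear_combination (norm := noncomm_ring) δ a b * x * (c * d - d * c) * y *
      (h - δ_comm_left a b c x - δ_comm_left a d c x)
      - δ a b * x * comm_δ_left a d c y * x * (c * b - b * c)
  have δ_central (a b r : R) : δ a b * r - r * δ a b = 0 := by
    refine semiprime _ fun z => ?_
    linear_combination (norm := noncomm_ring) δ_comm_all a b (δ a b) r (r * z)
      - r * δ_comm_all a b (δ a b) r z
  suffices h : δ x y = 0 by
    simp only [δ] at h
    rw [sub_sub, sub_eq_zero] at h
    exact h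
  set d := δ x y with hd
  have hd_zero (z u v : R) : d * z * (u * v - v * u) = 0 := δ_comm_all x y u v z
  have hd_central (r : R) : d * r - r * d = 0 := δ_central x y r
  have hd_two : d + d = D (x * y - y * x) - (D x * y - y * D x) - (x * D y - D y * x) := by
    have := map_mul_add_mul_of_map_sq hD x y
    simp only [hd, δ, map_sub]
    linear_combination (norm := noncomm_ring) this
  have hd_map : d * d * D (x * y - y * x) = 0 := by
    refine two _ ?_
    have h := map_mul_add_mul_of_map_sq hD d (x * y - y * x)
    have h₁ : d * (x * y - y * x) = 0 := by simpa using hd_zero 1 x y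
    have h₂ : (x * y - y * x) * d = 0 := by
      rw [← sub_eq_zero.mp (hd_central (x * y - y * x)), h₁]
    rw [h₁, h₂, map_zero, add_zero] at h
    linear_combination (norm := noncomm_ring) - d * h - hd_zero (D d) x y - h₁ * D d
      + d * hd_central (D (x * y - y * x))
  have hd_cube : d * d * d = 0 := by
    refine two _ ?_
    have h₁ := hd_zero 1 (D x) y
    have h₂ := hd_zero 1 x (D y)
    linear_combination (norm := noncomm_ring) d * d * hd_two + hd_map - d * h₁ - d * h₂
  have hd_sq : d * d = 0 := by
    refine semiprime _ fun z => ?_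
    linear_combination (norm := noncomm_ring) hd_cube * z * d - d * d * hd_central (z * d)
  refine semiprime _ fun z => ?_
  linear_combination (norm := noncomm_ring) hd_sq * z - d * hd_central z

end JordanDerivation

section SpectralFamily

open Set

variable {A : Type*} [CStarAlgebra A]

/-- Every right annihilator is generated by a self-adjoint element acting on it as a left unit. -/
def HasAnnihilatorUnits (A : Type*) [CStarAlgebra A] : Prop :=
  ∀ s : Set A, ∃ e : A, star e = e ∧ (∀ a ∈ s, a * e = 0) ∧
    ∀ y, (∀ a ∈ s, a * y = 0) → e * y = y

/-- `E t` plays the role of the spectral projection of `x` for the half-line `(-∞, t]`. -/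
structure IsSpectralFamily (x : A) (E : ℝ → A) : Prop where
  star_eq (t : ℝ) : star (E t) = E t
  mul_of_le {s t : ℝ} (h : s ≤ t) : E s * E t = E s
  sub_mul_cfc {a b : ℝ} (hab : a ≤ b) {φ : ℝ → ℝ} (hφ : Continuous φ)
    (h : ∀ s ∈ Icc a b, φ s = 0) : (E b - E a) * cfc φ x = 0
  exists_eq_zero : ∃ t, E t = 0
  exists_eq_one : ∃ t, E t = 1

theorem HasAnnihilatorUnits.exists_isSpectralFamily (hA : HasAnnihilatorUnits A) {x : A}
    (hx : IsSelfAdjoint x) : ∃ E, IsSpectralFamily x E := by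
  choose E hE_star hE_zero hE_unit using fun t : ℝ =>
    hA {a | ∃ φ : ℝ → ℝ, Continuous φ ∧ (∀ s ≤ t, φ s = 0) ∧ a = cfc φ x}
  have hE_cfc (t : ℝ) {φ : ℝ → ℝ} (hφ : Continuous φ) (h : ∀ s ≤ t, φ s = 0) :
      E t * cfc φ x = 0 := by
    have h₁ := congrArg star (hE_zero t _ ⟨φ, hφ, h, rfl⟩)
    rwa [star_mul, hE_star, star_zero, (cfc_predicate φ x : IsSelfAdjoint _).star_eq] at h₁
  have mul_of_ge {s t : ℝ} (h : s ≤ t) : E t * E s = E s := by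
    refine hE_unit t _ ?_
    rintro _ ⟨φ, hφ, hφ_zero, rfl⟩
    exact hE_zero s _ ⟨φ, hφ, fun r hr => hφ_zero r (hr.trans h), rfl⟩
  have mul_of_le {s t : ℝ} (h : s ≤ t) : E s * E t = E s := by
    simpa [hE_star] using congrArg star (mul_of_ge h)
  have h_spec {s : ℝ} (hs : s ∈ spectrum ℝ x) : |s| ≤ ‖x‖ * ‖(1 : A)‖ := by
    simpa using spectrum.norm_le_norm_mul_of_mem hs
  refine ⟨E, hE_star, mul_of_le, ?_, ⟨-(‖x‖ * ‖(1 : A)‖) - 1, ?_⟩, ⟨‖x‖ * ‖(1 : A)‖, ?_⟩⟩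
  · intro a b hab φ hφ h
    have ha : φ a = 0 := h a ⟨le_rfl, hab⟩
    have hb : φ b = 0 := h b ⟨hab, le_rfl⟩
    have h_low : Continuous fun s => φ (min s a) := by fun_prop
    have h_up : Continuous fun s => φ (max s b) := by fun_prop
    have h_split : cfc φ x = cfc (fun s => φ (min s a)) x + cfc (fun s => φ (max s b)) x := by
      rw [← cfc_add (a := x) (fun s => φ (min s a)) (fun s => φ (max s b))
        h_low.continuousOn h_up.continuousOn]
      congr 1
      funext s
      rcases le_total s a with hs | hs
      · simp [hs, hs.trans hab, hb]
      · rcases le_total s b with hs' | hs'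
        · simp [hs, hs', ha, hb, h s ⟨hs, hs'⟩]
        · simp [hs, hs', ha]
    have h_up_zero : E b * cfc (fun s => φ (max s b)) x = 0 :=
      hE_cfc b h_up fun s hs => by simp [hs, hb]
    have h_low_unit : E a * cfc (fun s => φ (min s a)) x = cfc (fun s => φ (min s a)) x := by
      refine hE_unit a _ ?_
      rintro _ ⟨χ, hχ, hχ_zero, rfl⟩
      rw [← cfc_mul χ _ x hχ.continuousOn h_low.continuousOn]
      convert cfc_const_zero ℝ x using 2
      funext s
      rcases le_total s a with hs | hs
      · simp [hχ_zero s hs]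
      · simp [hs, ha]
    have h_up_zero' : E a * cfc (fun s => φ (max s b)) x = 0 := by
      rw [← mul_of_le hab, mul_assoc, h_up_zero, mul_zero]
    have h_low_unit' : E b * cfc (fun s => φ (min s a)) x = cfc (fun s => φ (min s a)) x := by
      rw [← h_low_unit, ← mul_assoc, mul_of_ge hab]
    rw [h_split, sub_mul, mul_add, mul_add, h_up_zero, h_up_zero', h_low_unit, h_low_unit', sub_self]
  · have h := hE_cfc (-(‖x‖ * ‖(1 : A)‖) - 1)
      (φ := fun s => max (s + ‖x‖ * ‖(1 : A)‖ + 1) 0 - max (s + ‖x‖ * ‖(1 : A)‖) 0) (by fun_prop)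
      fun s hs => by
        rw [max_eq_right (by linarith), max_eq_right (by linarith), sub_zero]
    rw [cfc_congr (g := fun _ => 1), cfc_const_one ℝ x, mul_one] at h
    · exact h
    · intro s hs
      have := neg_le_of_abs_le (h_spec hs)
      simp only
      rw [max_eq_left (by linarith), max_eq_left (by linarith)]
      ring
  · rw [← mul_one (E _)]
    refine hE_unit _ _ ?_
    rintro _ ⟨φ, hφ, hφ_zero, rfl⟩
    rw [cfc_congr (g := fun _ => 0), cfc_const_zero, zero_mul]
    exact fun s hs => hφ_zero s (le_of_abs_le (h_spec hs))

theorem norm_add_sq_le_of_star_mul_eq_zero {y z : A} (h : star y * z = 0) :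
    ‖y + z‖ ^ 2 ≤ ‖y‖ ^ 2 + ‖z‖ ^ 2 := by
  have h' : star z * y = 0 := by simpa using congrArg star h
  have h_sum : star (y + z) * (y + z) = star y * y + star z * z := by
    rw [star_add, add_mul, mul_add, mul_add, h, h', add_zero, zero_add]
  simp only [sq, ← CStarRing.norm_star_mul_self, h_sum]
  exact norm_add_le _ _

namespace IsSpectralFamily

variable {x : A} {E : ℝ → A}

theorem mul_of_ge (hE : IsSpectralFamily x E) {s t : ℝ} (h : s ≤ t) : E t * E s = E s := by
  simpa [hE.star_eq] using congrArg star (hE.mul_of_le h)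

theorem isStarProjection_sub (hE : IsSpectralFamily x E) {a b : ℝ} (hab : a ≤ b) :
    IsStarProjection (E b - E a) where
  isIdempotentElem := by
    rw [IsIdempotentElem, sub_mul, mul_sub, mul_sub, hE.mul_of_le le_rfl, hE.mul_of_le le_rfl,
      hE.mul_of_le hab, hE.mul_of_ge hab, sub_self, sub_zero]
  isSelfAdjoint := by
    rw [IsSelfAdjoint, star_sub, hE.star_eq, hE.star_eq]

theorem norm_sub_mul_sq_le (hE : IsSpectralFamily x E) {a b c : ℝ} (hab : a ≤ b)
    (hbc : b ≤ c) (f : A) :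
    ‖(E c - E a) * f‖ ^ 2 ≤ ‖(E b - E a) * f‖ ^ 2 + ‖(E c - E b) * f‖ ^ 2 := by
  rw [show (E c - E a) * f = (E b - E a) * f + (E c - E b) * f by noncomm_ring]
  refine norm_add_sq_le_of_star_mul_eq_zero ?_
  rw [star_mul, star_sub, hE.star_eq, hE.star_eq, mul_assoc, ← mul_assoc (E b - E a), sub_mul,
    mul_sub, mul_sub, hE.mul_of_le hbc, hE.mul_of_le le_rfl, hE.mul_of_le (hab.trans hbc),
    hE.mul_of_le hab]
  simp

/-- If the spectral pieces of `f` are bounded linearly in the length of the interval, they vanish: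
the squares of the norms are subadditive. -/
theorem sub_mul_eq_zero_of_norm_le (hE : IsSpectralFamily x E) {a₀ b₀ K : ℝ} {f : A}
    (h₀ : a₀ ≤ b₀)
    (h : ∀ a b, a₀ ≤ a → a ≤ b → b ≤ b₀ → ‖(E b - E a) * f‖ ≤ K * (b - a)) :
    (E b₀ - E a₀) * f = 0 := by
  have h_bisect (n : ℕ) : ∀ a b, a₀ ≤ a → a ≤ b → b ≤ b₀ →
      ‖(E b - E a) * f‖ ^ 2 ≤ K ^ 2 * (b - a) ^ 2 * (1 / 2) ^ n := by
    induction n with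
    | zero =>
      intro a b ha hab hb
      rw [pow_zero, mul_one, ← mul_pow]
      exact pow_le_pow_left₀ (norm_nonneg _) (h a b ha hab hb) 2
    | succ n ih =>
      intro a b ha hab hb
      have h₁ := hE.norm_sub_mul_sq_le (b := (a + b) / 2) (by linarith : a ≤ (a + b) / 2)
        (by linarith : (a + b) / 2 ≤ b) f
      have h₂ := ih a ((a + b) / 2) ha (by linarith) (by linarith)
      have h₃ := ih ((a + b) / 2) b (by linarith) (by linarith) hb
      calc _ ≤ _ := h₁.trans (add_le_add h₂ h₃)
        _ = _ := by ring
  have h_lim : Filter.Tendsto (fun n : ℕ => K ^ 2 * (b₀ - a₀) ^ 2 * (1 / 2 : ℝ) ^ n) Filter.atTop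
      (nhds (K ^ 2 * (b₀ - a₀) ^ 2 * 0)) :=
    (tendsto_pow_atTop_nhds_zero_of_lt_one (by norm_num) (by norm_num)).const_mul _
  have h_le := ge_of_tendsto' h_lim fun n => h_bisect n a₀ b₀ le_rfl h₀ le_rfl
  rw [mul_zero] at h_le
  exact norm_eq_zero.mp (pow_eq_zero_iff two_ne_zero |>.mp (le_antisymm h_le (sq_nonneg _)))

/-- If `f ≠ 0` has no spectral mass at single points, its spectral mass accumulates at some point
from the right. -/
theorem exists_accumulation (hE : IsSpectralFamily x E) (hx : IsSelfAdjoint x) {f : A}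
    (hf : f ≠ 0)
    (h_atom : ∀ (u : A) (t : ℝ), star u = u → u * (x - algebraMap ℝ A t) = 0 → u * f = 0) :
    ∃ t₀, ∀ t > t₀, ∃ s ∈ Ioo t₀ t, (E t - E s) * f ≠ 0 := by
  obtain ⟨r₀, hr₀⟩ := hE.exists_eq_zero
  obtain ⟨r₁, hr₁⟩ := hE.exists_eq_one
  set Z : Set ℝ := {t | E t * f = 0} with hZ
  have hZ_down {s t : ℝ} (hst : s ≤ t) (ht : t ∈ Z) : s ∈ Z := by
    rw [hZ, mem_ofPred_eq] at ht ⊢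
    rw [← hE.mul_of_le hst, mul_assoc, ht, mul_zero]
  have hZ_ne : Z.Nonempty := ⟨r₀, by simp [hZ, hr₀]⟩
  have hZ_bdd : BddAbove Z := by
    refine ⟨r₁, fun t ht => ?_⟩
    by_contra! hlt
    have := hZ_down hlt.le ht
    simp [hZ, hr₁, hf] at this
  refine ⟨sSup Z, fun t ht => ?_⟩
  set t₀ := sSup Z with ht₀
  by_contra! h_const
  have h_pos : E t * f ≠ 0 := fun h => ht.not_ge (le_csSup hZ_bdd h)
  set g := E t * f with hg
  have hg_unit {ε : ℝ} (hε : 0 < ε) (hεt : t₀ + ε < t) : (E (t₀ + ε) - E (t₀ - ε)) * g = g := by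
    have h₁ := h_const (t₀ + ε) ⟨by linarith, hεt⟩
    have h₂ : E (t₀ - ε) * f = 0 := by
      obtain ⟨r, hr, hlt⟩ := exists_lt_of_lt_csSup hZ_ne (by linarith : t₀ - ε < sSup Z)
      exact hZ_down hlt.le hr
    rw [sub_mul, sub_eq_zero, ← hg] at h₁
    rw [hg, ← mul_assoc, sub_mul, hE.mul_of_le hεt.le, hE.mul_of_le (by linarith), sub_mul, h₂,
      sub_zero, ← h₁]
  have hg_small {ε : ℝ} (hε : 0 < ε) (hεt : t₀ + ε < t) :
      ‖star g * (x - algebraMap ℝ A t₀)‖ ≤ ‖g‖ * ε := by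
    have h_clamp : Continuous fun s : ℝ => max (-ε) (min ε (s - t₀)) := by fun_prop
    have h_cfc : (E (t₀ + ε) - E (t₀ - ε)) * (x - algebraMap ℝ A t₀) =
        (E (t₀ + ε) - E (t₀ - ε)) * cfc (fun s : ℝ => max (-ε) (min ε (s - t₀))) x := by
      have h := hE.sub_mul_cfc (a := t₀ - ε) (b := t₀ + ε) (by linarith)
        (φ := fun s => s - t₀ - max (-ε) (min ε (s - t₀))) (by fun_prop) fun s hs => by
          rw [min_eq_right (by linarith [hs.2]), max_eq_right (by linarith [hs.1]), sub_self]
      rw [cfc_sub (fun s => s - t₀) _ x (by fun_prop) h_clamp.continuousOn,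
        cfc_sub (fun s : ℝ => s) (fun _ => t₀) x (by fun_prop) (by fun_prop), cfc_id' ℝ x hx,
        cfc_const t₀ x hx, mul_sub, sub_eq_zero] at h
      exact h
    have h_star : star g = star g * (E (t₀ + ε) - E (t₀ - ε)) := by
      conv_lhs => rw [← hg_unit hε hεt]
      rw [star_mul, star_sub, hE.star_eq, hE.star_eq]
    rw [h_star, mul_assoc, h_cfc, ← mul_assoc, ← h_star]
    refine (norm_mul_le _ _).trans ?_
    rw [norm_star]
    gcongr
    refine norm_cfc_le hε.le fun s _ => ?_
    rw [Real.norm_eq_abs, abs_le]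
    exact ⟨le_max_left _ _, max_le (by linarith) (min_le_left _ _)⟩
  have hg_zero : star g * (x - algebraMap ℝ A t₀) = 0 := by
    rw [← norm_le_zero_iff]
    have h_lim : Filter.Tendsto (fun ε : ℝ => ‖g‖ * ε) (nhdsWithin 0 (Ioi 0)) (nhds (‖g‖ * 0)) :=
      ((continuous_const_mul ‖g‖).tendsto 0).mono_left nhdsWithin_le_nhds
    rw [mul_zero] at h_lim
    refine ge_of_tendsto h_lim ?_
    filter_upwards [Ioo_mem_nhdsGT (sub_pos.mpr ht)] with ε hε
    exact hg_small hε.1 (by linarith [hε.2])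
  have h_sq := h_atom (g * star g) t₀ (by simp) (by rw [mul_assoc, hg_zero, mul_zero])
  have h_star : star g * f = star g * g := by
    rw [hg, star_mul, hE.star_eq, mul_assoc, mul_assoc, ← mul_assoc (E t) (E t),
      hE.mul_of_le le_rfl]
  rw [mul_assoc, h_star] at h_sq
  have h_sq' : star (star g * g) * (star g * g) = 0 := by
    rw [star_mul, star_star, mul_assoc, h_sq, mul_zero]
  exact h_pos (CStarRing.star_mul_self_eq_zero_iff g |>.mp
    (CStarRing.star_mul_self_eq_zero_iff _ |>.mp h_sq'))

end IsSpectralFamily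

/-- A map that is local on the functional calculus of `x` and kills `1` also kills `x`. Otherwise
one builds a continuous function that is affine with rapidly growing slopes on disjoint intervals
carrying spectral mass of `S x`. -/
theorem HasAnnihilatorUnits.map_eq_zero_of_local (hA : HasAnnihilatorUnits A) {x : A}
    (hx : IsSelfAdjoint x) (S : A →ₗ[ℝ] A) (hS_one : S 1 = 0)
    (hS : ∀ (u : A) (φ : ℝ → ℝ), star u = u → Continuous φ → u * cfc φ x = 0 →
      u * S (cfc φ x) = 0) : S x = 0 := by
  by_contra hf
  obtain ⟨E, hE⟩ := hA.exists_isSpectralFamily hx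
  have hS_const (r : ℝ) : S (algebraMap ℝ A r) = 0 := by
    rw [Algebra.algebraMap_eq_smul_one, map_smul, hS_one, smul_zero]
  obtain ⟨t₀, ht₀⟩ := hE.exists_accumulation hx hf fun u t hu h => by
    have h_cfc : cfc (fun s => s - t) x = x - algebraMap ℝ A t := by
      rw [cfc_sub (fun s : ℝ => s) (fun _ => t) x (by fun_prop) (by fun_prop), cfc_id' ℝ x hx,
        cfc_const t x hx]
    have := hS u (fun s => s - t) hu (by fun_prop) (by rw [h_cfc, h])
    rwa [h_cfc, map_sub, hS_const, sub_zero] at this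
  have h_ratio (t K : ℝ) (ht : t₀ < t) :
      ∃ a b, t₀ < a ∧ a < b ∧ b ≤ t ∧ K * (b - a) < ‖(E b - E a) * S x‖ := by
    obtain ⟨s, hs, h_ne⟩ := ht₀ t ht
    by_contra! h_le
    refine h_ne (hE.sub_mul_eq_zero_of_norm_le (K := K) hs.2.le fun a b ha hab hb => ?_)
    rcases hab.eq_or_lt with rfl | hab
    · simp
    · exact h_le a b (hs.1.trans_le ha) hab hb
  choose! α β hα hαβ hβ h_large using h_ratio
  let t : ℕ → ℝ := fun n => Nat.rec (t₀ + 1) (fun n r => α r (4 ^ n)) n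
  set a : ℕ → ℝ := fun n => α (t n) (4 ^ n) with ha
  set b : ℕ → ℝ := fun n => β (t n) (4 ^ n) with hb
  have ht (n : ℕ) : t₀ < t n := by
    induction n with
    | zero => exact lt_add_one t₀
    | succ n ih => exact hα _ _ ih
  have hab (n : ℕ) : a n < b n := hαβ _ _ (ht n)
  have hbt (n : ℕ) : b n ≤ t n := hβ _ _ (ht n)
  have h_anti : Antitone t := antitone_nat_of_succ_le fun n => ((hab n).trans_le (hbt n)).le
  have h_disj {n m : ℕ} (h : n < m) : b m ≤ a n := (hbt m).trans (h_anti (Nat.succ_le_of_lt h))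
  let c : ℕ → ℝ := fun n => (1 / 2) ^ n / (b n - a n)
  have hc (n : ℕ) : 0 < c n := div_pos (by positivity) (sub_pos.mpr (hab n))
  let τ : ℕ → ℝ → ℝ := fun n s => c n * (max (a n) (min (b n) s) - a n)
  have hτ_cont (n : ℕ) : Continuous (τ n) := by fun_prop
  have hτ_le (n : ℕ) (s : ℝ) : ‖τ n s‖ ≤ (1 / 2) ^ n := by
    have h₁ : 0 ≤ max (a n) (min (b n) s) - a n := sub_nonneg.mpr (le_max_left _ _)
    have h₂ : max (a n) (min (b n) s) - a n ≤ b n - a n :=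
      sub_le_sub_right (max_le (hab n).le (min_le_left _ _)) _
    rw [Real.norm_of_nonneg (mul_nonneg (hc n).le h₁)]
    calc τ n s ≤ c n * (b n - a n) := mul_le_mul_of_nonneg_left h₂ (hc n).le
      _ = (1 / 2) ^ n := div_mul_cancel₀ _ (sub_pos.mpr (hab n)).ne'
  have h_geom : Summable fun n : ℕ => (1 / 2 : ℝ) ^ n := summable_geometric_two
  have hτ_sum (s : ℝ) : Summable fun n => τ n s := .of_norm_bounded h_geom fun n => hτ_le n s
  let ψ : ℝ → ℝ := fun s => ∑' n, τ n s
  have hψ_cont : Continuous ψ := continuous_tsum hτ_cont h_geom hτ_le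
  have hψ_affine (m : ℕ) {s : ℝ} (hs : s ∈ Icc (a m) (b m)) :
      ψ s - ψ (a m) = c m * (s - a m) := by
    simp only [ψ]
    rw [← (hτ_sum s).tsum_sub (hτ_sum (a m)), tsum_eq_single m]
    · simp only [τ]
      rw [min_eq_right hs.2, max_eq_right hs.1, min_eq_right (hab m).le, max_self]
      ring
    · intro n hn
      simp only [τ]
      rcases hn.lt_or_gt with h | h
      · have h₁ := h_disj h
        rw [max_eq_left ((min_le_right _ _).trans (hs.2.trans h₁)),
          max_eq_left ((min_le_right _ _).trans ((hab m).le.trans h₁)), sub_self]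
      · have h₁ := h_disj h
        rw [min_eq_left h₁, min_eq_left (h₁.trans hs.1), sub_self]
  have h_bound (m : ℕ) : (2 : ℝ) ^ m ≤ ‖S (cfc ψ x)‖ := by
    have h_proj := hE.isStarProjection_sub (hab m).le
    have h_cfc : cfc (fun s => ψ s - c m * s - (ψ (a m) - c m * a m)) x =
        cfc ψ x - c m • x - algebraMap ℝ A (ψ (a m) - c m * a m) := by
      rw [cfc_sub (fun s => ψ s - c m * s) _ x (by fun_prop) (by fun_prop),
        cfc_sub ψ _ x (by fun_prop) (by fun_prop), cfc_const_mul_id (c m) x hx, cfc_const _ x hx]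
    have h_zero := hS (E (b m) - E (a m)) (fun s => ψ s - c m * s - (ψ (a m) - c m * a m))
      h_proj.isSelfAdjoint (by fun_prop) (hE.sub_mul_cfc (hab m).le (by fun_prop) fun s hs => by
        linear_combination hψ_affine m hs)
    rw [h_cfc, map_sub, map_sub, hS_const, sub_zero, map_smul, mul_sub, sub_eq_zero,
      mul_smul_comm] at h_zero
    calc (2 : ℝ) ^ m = c m * (4 ^ m * (b m - a m)) := by
          have := (sub_pos.mpr (hab m)).ne'
          simp only [c]
          rw [show (4 : ℝ) ^ m = 2 ^ m * 2 ^ m by rw [← mul_pow]; norm_num, one_div, inv_pow]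
          field_simp
      _ ≤ c m * ‖(E (b m) - E (a m)) * S x‖ :=
          mul_le_mul_of_nonneg_left (h_large _ _ (ht m)).le (hc m).le
      _ = ‖(E (b m) - E (a m)) * S (cfc ψ x)‖ := by
          rw [h_zero, norm_smul, Real.norm_of_nonneg (hc m).le]
      _ ≤ 1 * ‖S (cfc ψ x)‖ := (norm_mul_le _ _).trans (by gcongr; exact h_proj.norm_le)
      _ = ‖S (cfc ψ x)‖ := one_mul _
  obtain ⟨m, hm⟩ := pow_unbounded_of_one_lt ‖S (cfc ψ x)‖ (one_lt_two (α := ℝ))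
  exact hm.not_ge (h_bound m)

end SpectralFamily

section GeneralizedDerivation

variable {A : Type*} [CStarAlgebra A]

theorem HasAnnihilatorUnits.mul_map_mul_eq_zero (hA : HasAnnihilatorUnits A) {T : A →ₗ[ℂ] A}
    (hT : ∀ a b : A, star a = a → star b = b → a * b = 0 → a * T b * a = 0) {a b c : A}
    (ha : star a = a) (hb : star b = b) (hab : a * b = 0) (hbc : b * c = 0) :
    a * T b * c = 0 := by
  obtain ⟨q, hq, hbq, hq_unit⟩ := hA {b}
  simp only [Set.mem_singleton_iff, forall_eq] at hbq hq_unit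
  have hqb : q * b = 0 := by simpa [hq, hb] using congrArg star hbq
  have hba : b * a = 0 := by simpa [ha, hb] using congrArg star hab
  have haq : a * q = a := by simpa [ha, hq] using congrArg star (hq_unit a hba)
  calc a * T b * c = a * (q * T b * q) * c := by
        conv_lhs => rw [← haq, ← hq_unit c hbc]
        noncomm_ring
    _ = 0 := by rw [hT q b hq hb hqb, mul_zero, zero_mul]

/-- On self-adjoint elements, a linear map vanishing at `1` with the annihilation property satisfies
the Leibniz rule for squares: the defect is local in each of its two variables separately. -/
theorem HasAnnihilatorUnits.map_sq_of_isSelfAdjoint (hA : HasAnnihilatorUnits A) {T : A →ₗ[ℂ] A}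
    (hT : ∀ a b : A, star a = a → star b = b → a * b = 0 → a * T b * a = 0) (hT_one : T 1 = 0)
    {x : A} (hx : IsSelfAdjoint x) : T (x * x) = T x * x + x * T x := by
  let L : A →ₗ[ℝ] A := T.restrictScalars ℝ
  have h_left {ψ : ℝ → ℝ} {v : A} (hv : cfc ψ x * v = 0) :
      (T (x * cfc ψ x) - x * T (cfc ψ x)) * v = 0 := by
    let S : A →ₗ[ℝ] A := LinearMap.mulRight ℝ v ∘ₗ
      (L ∘ₗ LinearMap.mulRight ℝ (cfc ψ x) - LinearMap.mulRight ℝ (T (cfc ψ x)))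
    refine hA.map_eq_zero_of_local hx S (by simp [S, L]) fun u φ hu hφ h => ?_
    have h_star : star (cfc φ x * cfc ψ x) = cfc φ x * cfc ψ x := by
      rw [star_mul, (cfc_predicate φ x : IsSelfAdjoint _).star_eq,
        (cfc_predicate ψ x : IsSelfAdjoint _).star_eq, (cfc_commute_cfc ψ φ x).eq]
    have h_zero := hA.mul_map_mul_eq_zero hT hu h_star (c := v)
      (by rw [← mul_assoc, h, zero_mul]) (by rw [mul_assoc, hv, mul_zero])
    have h_expand : u * S (cfc φ x) =
        u * T (cfc φ x * cfc ψ x) * v - u * cfc φ x * T (cfc ψ x) * v := by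
      simp only [S, L, LinearMap.comp_apply, LinearMap.sub_apply, LinearMap.mulRight_apply,
        LinearMap.restrictScalars_apply]
      noncomm_ring
    rw [h_expand, h_zero, h, zero_mul, zero_mul, sub_zero]
  let S : A →ₗ[ℝ] A := (starLinearEquiv ℝ : A ≃ₗ⋆[ℝ] A).toLinearMap ∘ₗ
    (L ∘ₗ LinearMap.mulLeft ℝ x - LinearMap.mulLeft ℝ x ∘ₗ L - LinearMap.mulLeft ℝ (T x))
  have hS (y : A) : S y = star (T (x * y) - x * T y - T x * y) := by
    simp [S, L]
  have h_zero : S x = 0 := by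
    refine hA.map_eq_zero_of_local hx S (by simp [hS, hT_one]) fun u φ hu hφ h => ?_
    have hv : cfc φ x * u = 0 := by
      simpa [hu, (cfc_predicate φ x : IsSelfAdjoint _).star_eq] using congrArg star h
    rw [hS, ← hu, ← star_mul, star_eq_zero, sub_mul, h_left hv, mul_assoc, hv, mul_zero, sub_zero]
  rw [hS, star_eq_zero] at h_zero
  rw [sub_sub, sub_eq_zero] at h_zero
  rw [h_zero, add_comm]

theorem HasAnnihilatorUnits.map_sq (hA : HasAnnihilatorUnits A) {T : A →ₗ[ℂ] A}
    (hT : ∀ a b : A, star a = a → star b = b → a * b = 0 → a * T b * a = 0) (hT_one : T 1 = 0)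
    (x : A) : T (x * x) = T x * x + x * T x := by
  have h_add {y z : A} (hy : IsSelfAdjoint y) (hz : IsSelfAdjoint z) :
      T (y * z) + T (z * y) = T y * z + y * T z + T z * y + z * T y := by
    have h := hA.map_sq_of_isSelfAdjoint hT hT_one (hy.add hz)
    simp only [mul_add, add_mul, map_add] at h
    linear_combination (norm := noncomm_ring) h - hA.map_sq_of_isSelfAdjoint hT hT_one hy
      - hA.map_sq_of_isSelfAdjoint hT hT_one hz
  obtain ⟨y, z, hy, hz, rfl⟩ : ∃ y z : A, IsSelfAdjoint y ∧ IsSelfAdjoint z ∧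
      x = y + Complex.I • z :=
    ⟨realPart x, imaginaryPart x, (realPart x).2, (imaginaryPart x).2,
      (realPart_add_I_smul_imaginaryPart x).symm⟩
  have h₁ := hA.map_sq_of_isSelfAdjoint hT hT_one hy
  have h₂ := hA.map_sq_of_isSelfAdjoint hT hT_one hz
  simp only [mul_add, add_mul, map_add, map_smul, smul_mul_assoc, mul_smul_comm, h₁, h₂]
  linear_combination (norm := (simp only [smul_add]; abel))
    congrArg (Complex.I • ·) (h_add hy hz)

/-- A linear map with `a T(b) a = 0` for all self-adjoint `a`, `b` with `a b = 0` is a generalized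
derivation. -/
theorem HasAnnihilatorUnits.map_mul (hA : HasAnnihilatorUnits A) {T : A →ₗ[ℂ] A}
    (hT : ∀ a b : A, star a = a → star b = b → a * b = 0 → a * T b * a = 0) (x y : A) :
    T (x * y) = T x * y + x * T y - x * T 1 * y := by
  let D : A →ₗ[ℂ] A := T - LinearMap.mulLeft ℂ (T 1)
  have hD (z : A) : D z = T z - T 1 * z := rfl
  have hD_annihilates (a b : A) (ha : star a = a) (hb : star b = b) (hab : a * b = 0) :
      a * D b * a = 0 := by
    have hba : b * a = 0 := by simpa [ha, hb] using congrArg star hab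
    rw [hD, mul_sub, sub_mul, hT a b ha hb hab, mul_assoc, mul_assoc, hba, mul_zero, mul_zero,
      sub_zero]
  have h_two (r : A) (hr : r + r = 0) : r = 0 := by
    rw [← two_smul ℂ r] at hr
    exact (smul_eq_zero.mp hr).resolve_left two_ne_zero
  have h_semiprime (r : A) (hr : ∀ z, r * z * r = 0) : r = 0 := by
    rw [← CStarRing.star_mul_self_eq_zero_iff, ← CStarRing.star_mul_self_eq_zero_iff, star_mul,
      star_star, mul_assoc, ← mul_assoc r, hr, mul_zero]
  have h := map_mul_of_map_sq (D := D.toAddMonoidHom) h_two h_semiprime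
    (hA.map_sq hD_annihilates (by simp [hD])) x y
  simp only [LinearMap.toAddMonoidHom_coe, hD] at h
  linear_combination (norm := noncomm_ring) h

end GeneralizedDerivation

namespace VonNeumannAlgebra

variable {H : Type*} [NormedAddCommGroup H] [InnerProductSpace ℂ H] [CompleteSpace H]

theorem isClosed_toStarSubalgebra (M : VonNeumannAlgebra H) :
    IsClosed (M.toStarSubalgebra : Set (H →L[ℂ] H)) := by
  rw [coe_toStarSubalgebra, ← M.centralizer_centralizer]
  exact Set.isClosed_centralizer _

theorem exists_annihilator_unit (M : VonNeumannAlgebra H) (s : Set M.toStarSubalgebra) :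
    ∃ e : M.toStarSubalgebra, star e = e ∧ (∀ a ∈ s, a * e = 0) ∧
      ∀ y, (∀ a ∈ s, a * y = 0) → e * y = y := by
  let K : Submodule ℂ H := ⨅ a ∈ s, (a : H →L[ℂ] H).ker
  have hK (v : H) : v ∈ K ↔ ∀ a ∈ s, (a : H →L[ℂ] H) v = 0 := by simp [K]
  have hK_closed : IsClosed (K : Set H) := by
    have : (K : Set H) = ⋂ a ∈ s, {v | (a : H →L[ℂ] H) v = 0} := by ext v; simp [hK]
    rw [this]
    exact isClosed_biInter fun a _ => isClosed_eq (a : H →L[ℂ] H).continuous continuous_const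
  have : CompleteSpace K := hK_closed.completeSpace_coe
  have h_mem : K.starProjection ∈ M := by
    rw [IsStarProjection.mem_iff isStarProjection_starProjection]
    intro y hy
    rw [Submodule.range_starProjection, Module.End.mem_invtSubmodule_iff_forall_mem_of_mem]
    intro v hv
    rw [hK] at hv ⊢
    intro a ha
    have h_comm := congrArg (· v) (mem_commutant_iff.mp hy a a.2)
    simpa [hv a ha] using h_comm
  refine ⟨⟨K.starProjection, h_mem⟩, ?_, ?_, ?_⟩
  · exact Subtype.ext isStarProjection_starProjection.isSelfAdjoint
  · intro a ha
    refine Subtype.ext (ContinuousLinearMap.ext fun v => ?_)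
    exact (hK _).mp (K.starProjection_apply_mem v) a ha
  · intro y hy
    refine Subtype.ext (ContinuousLinearMap.ext fun v => ?_)
    refine Submodule.starProjection_eq_self_iff.mpr ((hK _).mpr fun a ha => ?_)
    exact congrArg (fun z : M.toStarSubalgebra => (z : H →L[ℂ] H) v) (hy a ha)

end VonNeumannAlgebra

/-- Characterizations of (not necessarily continuous) generalized derivations on a
von Neumann algebra. -/
theorem stmt14 {H : Type*} [NormedAddCommGroup H] [InnerProductSpace ℂ H] [CompleteSpace H]
    (M : VonNeumannAlgebra H)
    (T : M.toStarSubalgebra →ₗ[ℂ] M.toStarSubalgebra) :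
    [ (∀ x y : M.toStarSubalgebra, T (x * y) = T x * y + x * T y - x * T 1 * y),
      (∀ a b c : M.toStarSubalgebra, a * b = 0 → b * c = 0 → a * T b * c = 0),
      (∀ a b c : M.toStarSubalgebra, star a = a → star b = b → star c = c →
        a * b = 0 → b * c = 0 → a * T b * c = 0),
      (∀ a b c : M.toStarSubalgebra, star a = a → star b = b → star c = c →
        a * b = 0 → b * c = 0 → a * T b * c + c * T b * a = 0),
      (∀ a b : M.toStarSubalgebra, star a = a → star b = b → a * b = 0 →
        a * T b * a = 0) ].TFAE := by
  tfae_have 1 → 2 := by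
    intro h a b c hab hbc
    have h_bc := h b c
    rw [hbc, map_zero] at h_bc
    linear_combination (norm := noncomm_ring) -(a * h_bc) - hab * T c + hab * T 1 * c
  tfae_have 2 → 3 := fun h a b c _ _ _ => h a b c
  tfae_have 3 → 4 := by
    intro h a b c ha hb hc hab hbc
    have hcb : c * b = 0 := by simpa [hb, hc] using congrArg star hbc
    have hba : b * a = 0 := by simpa [ha, hb] using congrArg star hab
    rw [h a b c ha hb hc hab hbc, h c b a hc hb ha hcb hba, add_zero]
  tfae_have 4 → 5 := by
    intro h a b ha hb hab
    have hba : b * a = 0 := by simpa [ha, hb] using congrArg star hab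
    have h_two := h a b a ha hb ha hab hba
    rw [← two_smul ℂ] at h_two
    exact (smul_eq_zero.mp h_two).resolve_left two_ne_zero
  tfae_have 5 → 1 := by
    intro h
    have := M.isClosed_toStarSubalgebra
    exact HasAnnihilatorUnits.map_mul (A := M.toStarSubalgebra) M.exists_annihilator_unit h
  tfae_finish
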